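/- Let {x_k}_{k=1}^∞ be a Bessel sequence in the real Hilbert space ℓ₂. Then the family {x̃_k}_{k=1}^∞ is a Bessel sequence in H̃; however, {x̃_k}_{k=1}^∞ is never a frame for H̃, i.e., it fails to have a positive lower frame bound. -/

import Mathlib

open scoped InnerProductSpace

/-- The real Hilbert space `ℓ₂`. -/
abbrev ell2 : Type := lp (fun _ : ℕ => ℝ) 2

/-- `H̃`, the `ℓ₂` direct sum of countably many copies of the real `ℓ₂`. -/
abbrev Htilde : Type := lp (fun _ : ℕ => ell2) 2

lemma hasSum_congr_aux {f g : ℕ → ℝ} {a : ℝ} (h : ∀ i, f i = g i) (hf : HasSum f a) :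
    HasSum g a := by
  rwa [← funext h]

lemma ell2_norm_sq (v : ell2) : HasSum (fun i => v i ^ 2) (‖v‖ ^ 2) := by
  have h := lp.hasSum_inner (𝕜 := ℝ) v v
  rw [real_inner_self_eq_norm_sq] at h
  refine hasSum_congr_aux (fun i => ?_) h
  simp [pow_two]

lemma Htilde_norm_sq (v : Htilde) : HasSum (fun i => ‖v i‖ ^ 2) (‖v‖ ^ 2) := by
  have h := lp.hasSum_inner (𝕜 := ℝ) v v
  rw [real_inner_self_eq_norm_sq] at h
  refine hasSum_congr_aux (fun i => ?_) h
  simp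

lemma ell2_inner (v w : ell2) : HasSum (fun i => v i * w i) ⟪v, w⟫_ℝ := by
  have h := lp.hasSum_inner (𝕜 := ℝ) v w
  refine hasSum_congr_aux (fun i => ?_) h
  simp [mul_comm]

lemma exists_ell2 (f : ℕ → ℝ) (hf : Summable fun i => f i ^ 2) :
    ∃ v : ell2, ∀ i, v i = f i := by
  refine ⟨⟨f, ?_⟩, fun i => rfl⟩
  apply memℓp_gen
  simpa using hf

lemma exists_shift (u : ell2) (i : ℕ) : ∃ v : ell2, ‖v‖ ^ 2 = ‖u‖ ^ 2 ∧
    ∀ x : ell2, HasSum (fun j => u j * x (i + j)) ⟪v, x⟫_ℝ := by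
  have inj : Function.Injective (fun j : ℕ => i + j) := fun a b h => by simpa using h
  let f : ℕ → ℝ := fun m => if i ≤ m then u (m - i) else 0
  have h0 : ∀ m, m ∉ Set.range (fun j : ℕ => i + j) → f m = 0 := by
    intro m hm
    by_cases h : i ≤ m
    · exact absurd ⟨m - i, by simp; omega⟩ hm
    · simp [f, h]
  have h1 : ∀ j, f (i + j) = u j := by intro j; simp [f]
  have hs : HasSum (fun m => f m ^ 2) (‖u‖ ^ 2) := by
    rw [← inj.hasSum_iff (by intro m hm; simp [h0 m hm])]
    simpa [Function.comp_def, h1] using ell2_norm_sq u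
  obtain ⟨v, hv⟩ := exists_ell2 f hs.summable
  refine ⟨v, ?_, ?_⟩
  · have := ell2_norm_sq v
    simp only [hv] at this
    exact this.unique hs
  · intro x
    have := ell2_inner v x
    simp only [hv] at this
    rw [← inj.hasSum_iff (by intro m hm; simp [h0 m hm])] at this
    simpa [Function.comp_def, h1] using this

/-- Let `{x_k}_{k=1}^∞` be a Bessel sequence in the real `ℓ₂`, and
let `{y_k}_{k=1}^∞` be the corresponding family of tilde vectors in `H̃`
(so `y_k = x̃_k`, i.e. `(y_k)_{i,j} = x_{k,i} · x_{k,i+j}`).  Then `{y_k}` is a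
Bessel sequence in `H̃`, but it fails to have a positive lower frame bound
(hence is never a frame for `H̃`). -/
theorem stmt_16 (x : ℕ → ell2)
    (hBessel : ∃ B : ℝ, 0 < B ∧ ∀ v : ell2,
      (Summable fun k => ⟪v, x k⟫_ℝ ^ 2) ∧ ∑' k, ⟪v, x k⟫_ℝ ^ 2 ≤ B * ‖v‖ ^ 2)
    (y : ℕ → Htilde) (hy : ∀ k i j, y k i j = x k i * x k (i + j)) :
    (∃ B : ℝ, 0 < B ∧ ∀ a : Htilde,
      (Summable fun k => ⟪a, y k⟫_ℝ ^ 2) ∧ ∑' k, ⟪a, y k⟫_ℝ ^ 2 ≤ B * ‖a‖ ^ 2) ∧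
    ¬ (∃ A : ℝ, 0 < A ∧ ∀ a : Htilde, A * ‖a‖ ^ 2 ≤ ∑' k, ⟪a, y k⟫_ℝ ^ 2) := by
  obtain ⟨B, hB, hx⟩ := hBessel
  have hxB : ∀ k, ‖x k‖ ^ 2 ≤ B := by
    intro k
    obtain ⟨h1, h2⟩ := hx (x k)
    have h3 := h1.le_tsum k (fun j _ => sq_nonneg _)
    rw [real_inner_self_eq_norm_sq] at h3
    by_contra hcon
    push Not at hcon
    nlinarith
  constructor
  · refine ⟨B * B, by positivity, fun a => ?_⟩
    choose v hvn hv using fun i => exists_shift (a i) i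
    have ha := Htilde_norm_sq a
    have hF1 : ∀ i, ∑' k, ⟪v i, x k⟫_ℝ ^ 2 ≤ B * ‖a i‖ ^ 2 := fun i => by
      rw [← hvn]; exact (hx (v i)).2
    have hS1 : Summable fun i => ∑' k, ⟪v i, x k⟫_ℝ ^ 2 :=
      Summable.of_nonneg_of_le (fun i => tsum_nonneg fun k => sq_nonneg _) hF1
        (ha.summable.mul_left B)
    have hS : Summable fun p : ℕ × ℕ => ⟪v p.1, x p.2⟫_ℝ ^ 2 :=
      (summable_prod_of_nonneg (fun p => sq_nonneg _)).2 ⟨fun i => (hx (v i)).1, hS1⟩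
    have hS' : Summable fun p : ℕ × ℕ => ⟪v p.2, x p.1⟫_ℝ ^ 2 := hS.prod_symm
    have hS2 := (summable_prod_of_nonneg (fun p => sq_nonneg _)).1 hS'
    have htot : ∑' k, ∑' i, ⟪v i, x k⟫_ℝ ^ 2 ≤ B * ‖a‖ ^ 2 := by
      rw [Summable.tsum_comm (f := fun i k => ⟪v i, x k⟫_ℝ ^ 2) hS, ← ha.tsum_eq, ← tsum_mul_left]
      exact hS1.tsum_le_tsum hF1 (ha.summable.mul_left B)
    have key : ∀ k, ⟪a, y k⟫_ℝ ^ 2 ≤ B * ∑' i, ⟪v i, x k⟫_ℝ ^ 2 := by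
      intro k
      obtain ⟨w, hw⟩ := exists_ell2 (fun i => ⟪v i, x k⟫_ℝ) (hS2.1 k)
      have hwn := (ell2_norm_sq w).tsum_eq
      simp only [hw] at hwn
      have e : ⟪a, y k⟫_ℝ = ⟪x k, w⟫_ℝ := by
        have h1 := lp.hasSum_inner (𝕜 := ℝ) a (y k)
        refine h1.unique ?_
        refine hasSum_congr_aux (fun i => ?_) (ell2_inner (x k) w)
        symm
        rw [hw]
        refine (ell2_inner (a i) (y k i)).unique ?_
        refine hasSum_congr_aux (fun j => ?_) ((hv i (x k)).mul_left (x k i))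
        rw [hy]; ring
      rw [e, hwn]
      have := abs_real_inner_le_norm (x k) w
      calc ⟪x k, w⟫_ℝ ^ 2 = |⟪x k, w⟫_ℝ| ^ 2 := (sq_abs _).symm
        _ ≤ (‖x k‖ * ‖w‖) ^ 2 := by gcongr
        _ = ‖x k‖ ^ 2 * ‖w‖ ^ 2 := by ring
        _ ≤ B * ‖w‖ ^ 2 := by gcongr; exact hxB k
    have hsum : Summable fun k => ⟪a, y k⟫_ℝ ^ 2 :=
      Summable.of_nonneg_of_le (fun k => sq_nonneg _) key (hS2.2.mul_left B)
    refine ⟨hsum, ?_⟩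
    calc _ ≤ ∑' k, B * ∑' i, ⟪v i, x k⟫_ℝ ^ 2 := hsum.tsum_le_tsum key (hS2.2.mul_left B)
      _ = B * ∑' k, ∑' i, ⟪v i, x k⟫_ℝ ^ 2 := tsum_mul_left
      _ ≤ B * (B * ‖a‖ ^ 2) := by gcongr
      _ = _ := by ring
  · rintro ⟨A, hA, h⟩
    have hlow : ∀ n : ℕ, A ≤ ∑' k, (x k 0 * x k n) ^ 2 := by
      intro n
      have := h (lp.single 2 0 (lp.single 2 n (1 : ℝ)))
      simpa [lp.norm_single, lp.inner_single_left, hy] using this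
    have hs0 : Summable fun k => x k 0 ^ 2 := by
      have := (hx (lp.single 2 0 (1 : ℝ))).1
      simpa [lp.inner_single_left] using this
    have hlim : Filter.Tendsto (fun n : ℕ => ∑' k, (x k 0 * x k n) ^ 2) Filter.atTop
        (nhds (∑' _ : ℕ, (0 : ℝ))) := by
      refine tendsto_tsum_of_dominated_convergence (bound := fun k => x k 0 ^ 2 * B)
        (hs0.mul_right B) ?_ ?_
      · intro k
        have := (ell2_norm_sq (x k)).summable.tendsto_atTop_zero
        simpa [mul_pow] using this.const_mul (x k 0 ^ 2)
      · refine Filter.Eventually.of_forall fun n k => ?_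
        rw [Real.norm_of_nonneg (sq_nonneg _), mul_pow]
        have h1 := le_hasSum (ell2_norm_sq (x k)) n (fun j _ => sq_nonneg _)
        have := h1.trans (hxB k)
        gcongr
    rw [tsum_zero] at hlim
    exact absurd (ge_of_tendsto' hlim hlow) (not_le.2 hA)
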